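/- arXiv:2102.08868 — 2 statements merged into one kernel-verified Lean document; each statement's English description precedes it below -/
import Mathlib

section
/- Let ‖·‖ be a norm on ℝ^d with dual norm ‖·‖_*. Let x_1,…,x_n ∈ ℝ^d with labels y_1,…,y_n ∈ {−1,+1} be a linearly separable (affine) dataset in which both labels occur, and suppose (w*, b*) minimizes ‖w‖_* subject to y_i(⟨w,x_i⟩+b) ≥ 1 for all i. Set ε* := 1/‖w*‖_*. Then: (a) for every ε < ε*, every i, and every δ ∈ ℝ^d with ‖δ‖ ≤ ε, one has y_i(⟨w*, x_i + δ⟩ + b*) > 0; and (b) for every ε > ε* there exist no w ∈ ℝ^d, b ∈ ℝ such that y_i(⟨w, x_i + δ⟩ + b) > 0 for all i and all ‖δ‖ ≤ ε. In particular (w*, b*) is a maximally robust linear classifier. -/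
open scoped BigOperators

/-- The dual norm of a norm `N` on `ℝ^d`, w.r.t. the standard inner product. -/
noncomputable def dualNorm {d : ℕ} (N : (Fin d → ℝ) → ℝ) (w : Fin d → ℝ) : ℝ :=
  sSup {t : ℝ | ∃ u : Fin d → ℝ, N u ≤ 1 ∧ t = |∑ j, w j * u j|}

/-- On a finite-dimensional space, a linear functional is bounded by a multiple of any norm. -/
lemma Seminorm.exists_abs_le_mul {E : Type*} [AddCommGroup E] [Module ℝ E]
    [FiniteDimensional ℝ E] (p : Seminorm ℝ E) (hp : ∀ v, p v = 0 → v = 0) (f : E →ₗ[ℝ] ℝ) :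
    ∃ C : ℝ, 0 ≤ C ∧ ∀ v, |f v| ≤ C * p v := by
  let q : AddGroupNorm E :=
    { p.toAddGroupSeminorm with eq_zero_of_map_eq_zero' := hp }
  let _ : NormedAddCommGroup E := q.toNormedAddCommGroup
  let _ : NormedSpace ℝ E := { norm_smul_le := fun c v => (map_smul_eq_mul p c v).le }
  exact ⟨‖LinearMap.toContinuousLinearMap f‖, norm_nonneg _,
    (LinearMap.toContinuousLinearMap f).le_opNorm⟩

section DualNorm

variable {d : ℕ} {N : (Fin d → ℝ) → ℝ} {w : Fin d → ℝ}

lemma dualNorm_nonneg : 0 ≤ dualNorm N w :=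
  Real.sSup_nonneg (by rintro _ ⟨u, -, rfl⟩; exact abs_nonneg _)

lemma dualNorm_le {c : ℝ} (hc : 0 ≤ c) (h : ∀ u, N u ≤ 1 → |w ⬝ᵥ u| ≤ c) :
    dualNorm N w ≤ c :=
  Real.sSup_le (by rintro _ ⟨u, hu, rfl⟩; exact h u hu) hc

lemma abs_dotProduct_le_dualNorm_mul
    (hN_tri : ∀ u v, N (u + v) ≤ N u + N v)
    (hN_smul : ∀ (c : ℝ) v, N (c • v) = |c| * N v)
    (hN_eq : ∀ v, N v = 0 → v = 0) (w u : Fin d → ℝ) :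
    |w ⬝ᵥ u| ≤ dualNorm N w * N u := by
  let p : Seminorm ℝ (Fin d → ℝ) := Seminorm.of N hN_tri hN_smul
  obtain ⟨C, hC, hw⟩ := p.exists_abs_le_mul hN_eq (dotProductBilin ℝ ℝ w)
  rcases eq_or_ne u 0 with rfl | hu
  · rw [dotProduct_zero, abs_zero]
    exact mul_nonneg dualNorm_nonneg (apply_nonneg p 0)
  have hpos : 0 < N u := lt_of_le_of_ne (apply_nonneg p u) fun h => hu (hN_eq u h.symm)
  have hbdd : BddAbove {t : ℝ | ∃ u : Fin d → ℝ, N u ≤ 1 ∧ t = |∑ j, w j * u j|} := by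
    refine ⟨C, ?_⟩
    rintro _ ⟨v, hv, rfl⟩
    exact (hw v).trans (mul_le_of_le_one_right hC hv)
  have hle : |w ⬝ᵥ ((N u)⁻¹ • u)| ≤ dualNorm N w := by
    refine le_csSup hbdd ⟨(N u)⁻¹ • u, ?_, rfl⟩
    rw [hN_smul, abs_of_pos (inv_pos.2 hpos), inv_mul_cancel₀ hpos.ne']
  rwa [dotProduct_smul, smul_eq_mul, abs_mul, abs_of_pos (inv_pos.2 hpos),
    inv_mul_le_iff₀ hpos, mul_comm] at hle

end DualNorm

/-- A minimum-dual-norm classifier `(w*, b*)` is maximally robust: it is robust to all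
perturbations of norm `≤ ε` for every `ε < 1/‖w*‖_*`, and no affine classifier is robust
for any `ε > 1/‖w*‖_*`. -/
theorem stmt3 {d n : ℕ} (hn : 0 < n)
    (N : (Fin d → ℝ) → ℝ)
    (hN_tri : ∀ u v : Fin d → ℝ, N (u + v) ≤ N u + N v)
    (hN_smul : ∀ (c : ℝ) (v : Fin d → ℝ), N (c • v) = |c| * N v)
    (hN_eq : ∀ v : Fin d → ℝ, N v = 0 → v = 0)
    (x : Fin n → Fin d → ℝ) (y : Fin n → ℝ)
    (hy : ∀ i, y i = 1 ∨ y i = -1)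
    (hboth : (∃ i, y i = 1) ∧ (∃ i, y i = -1))
    (hsep : ∃ (w : Fin d → ℝ) (b : ℝ), ∀ i, 0 < y i * ((∑ j, w j * x i j) + b))
    (wstar : Fin d → ℝ) (bstar : ℝ)
    (hfeas : ∀ i, 1 ≤ y i * ((∑ j, wstar j * x i j) + bstar))
    (hmin : ∀ (w : Fin d → ℝ) (b : ℝ), (∀ i, 1 ≤ y i * ((∑ j, w j * x i j) + b)) →
        dualNorm N wstar ≤ dualNorm N w) :
    (∀ ε : ℝ, ε < (dualNorm N wstar)⁻¹ →
        ∀ (i : Fin n) (δ : Fin d → ℝ), N δ ≤ ε →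
          0 < y i * ((∑ j, wstar j * (x i j + δ j)) + bstar)) ∧
    (∀ ε : ℝ, (dualNorm N wstar)⁻¹ < ε →
        ¬ ∃ (w : Fin d → ℝ) (b : ℝ), ∀ (i : Fin n) (δ : Fin d → ℝ), N δ ≤ ε →
            0 < y i * ((∑ j, w j * (x i j + δ j)) + b)) := by
  have habs (w u : Fin d → ℝ) : |w ⬝ᵥ u| ≤ dualNorm N w * N u :=
    abs_dotProduct_le_dualNorm_mul hN_tri hN_smul hN_eq w u
  change ∀ i, 1 ≤ y i * (wstar ⬝ᵥ x i + bstar) at hfeas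
  have hpos : 0 < dualNorm N wstar := by
    obtain ⟨⟨i, hi⟩, ⟨k, hk⟩⟩ := hboth
    refine lt_of_le_of_ne dualNorm_nonneg fun h => ?_
    have hle := habs wstar (x i - x k)
    rw [← h, zero_mul, dotProduct_sub] at hle
    have hfi := hfeas i
    have hfk := hfeas k
    rw [hi] at hfi
    rw [hk] at hfk
    linarith [le_abs_self (wstar ⬝ᵥ x i - wstar ⬝ᵥ x k)]
  refine ⟨fun ε hε i δ hδ => ?_, ?_⟩
  · change 0 < y i * (wstar ⬝ᵥ (x i + δ) + bstar)
    have hlt : |wstar ⬝ᵥ δ| < 1 := by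
      refine (habs wstar δ).trans_lt ?_
      rw [← mul_inv_cancel₀ hpos.ne']
      exact mul_lt_mul_of_pos_left (hδ.trans_lt hε) hpos
    have hfi := hfeas i
    rw [dotProduct_add]
    rw [abs_lt] at hlt
    rcases hy i with h | h <;> rw [h] at hfi ⊢ <;> linarith
  · rintro ε hε ⟨w, b, hrob⟩
    change ∀ i δ, N δ ≤ ε → 0 < y i * (w ⬝ᵥ (x i + δ) + b) at hrob
    have hεpos : 0 < ε := (inv_pos.2 hpos).trans hε
    have hN_zero : N 0 = 0 := by simpa using hN_smul 0 0
    have : Nonempty (Fin n) := ⟨⟨0, hn⟩⟩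
    obtain ⟨i, hi⟩ := Finite.exists_min fun i => y i * (w ⬝ᵥ x i + b)
    set m := y i * (w ⬝ᵥ x i + b)
    have hm : 0 < m := by simpa using hrob i 0 (hN_zero.trans_le hεpos.le)
    have hmargin (u : Fin d → ℝ) (hu : N u ≤ 1) : ε * |w ⬝ᵥ u| ≤ m := by
      have hbound (c : ℝ) (hc : |c| = ε) : 0 < m + y i * (c * (w ⬝ᵥ u)) := by
        have h := hrob i (c • u) (by
          rw [hN_smul, hc]
          exact mul_le_of_le_one_right hεpos.le hu)
        rw [dotProduct_add, dotProduct_smul, smul_eq_mul] at h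
        linarith
      have h₁ := hbound ε (abs_of_pos hεpos)
      have h₂ := hbound (-ε) (by rw [abs_neg, abs_of_pos hεpos])
      rw [← abs_of_pos hεpos, ← abs_mul, abs_le]
      rcases hy i with h | h <;> rw [h] at h₁ h₂ <;> constructor <;> linarith
    have hle : dualNorm N wstar ≤ ε⁻¹ := by
      refine (hmin (m⁻¹ • w) (m⁻¹ * b) fun k => ?_).trans
        (dualNorm_le (inv_nonneg.2 hεpos.le) fun u hu => ?_)
      · change 1 ≤ y k * ((m⁻¹ • w) ⬝ᵥ x k + m⁻¹ * b)
        rw [smul_dotProduct, smul_eq_mul, ← mul_add, mul_left_comm, ← div_eq_inv_mul,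
          one_le_div hm]
        exact hi k
      · rw [smul_dotProduct, smul_eq_mul, abs_mul, abs_of_pos (inv_pos.2 hm),
          inv_mul_le_iff₀ hm, ← div_eq_mul_inv, le_div_iff₀ hεpos, mul_comm]
        exact hmargin u hu
    exact absurd hle (not_le.2 (inv_lt_of_inv_lt₀ hpos hε))
end

section
/- Let ‖·‖ be a norm on ℝ^d with dual norm ‖·‖_*, let x_1,…,x_n ∈ ℝ^d with labels y_1,…,y_n ∈ {−1,+1} be linearly separable through the origin, and let L(w) := Σ_{i=1}^n exp(−y_i⟨w, x_i⟩). Suppose the maximizer w* of min_i y_i⟨w, x_i⟩ over {w : ‖w‖ ≤ 1} is unique, with value γ > 0, and for each λ > 0 let ŵ(λ) be a minimizer of L(w) + λ‖w‖. Then ŵ(λ)/‖ŵ(λ)‖ → w* as λ → 0⁺, and w* is maximally robust with respect to ‖·‖_*: for every ε < γ, every i, and every δ ∈ ℝ^d with ‖δ‖_* ≤ ε, y_i⟨w*, x_i + δ⟩ > 0, while for every ε > γ no w ∈ ℝ^d has this robustness property. -/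
open scoped BigOperators

section SeminormFiniteDimensional

variable {E : Type*} [NormedAddCommGroup E] [NormedSpace ℝ E] [FiniteDimensional ℝ E]

theorem Seminorm.continuous_of_finiteDimensional_real (p : Seminorm ℝ E) : Continuous p :=
  continuousOn_univ.1 (p.convexOn.continuousOn isOpen_univ)

theorem Seminorm.exists_pos_mul_norm_le (p : Seminorm ℝ E) (hp : ∀ v, p v = 0 → v = 0) :
    ∃ c : ℝ, 0 < c ∧ ∀ v, c * ‖v‖ ≤ p v := by
  have hproper : ProperSpace E := FiniteDimensional.proper ℝ E
  rcases (Metric.sphere (0 : E) 1).eq_empty_or_nonempty with hS | hS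
  · refine ⟨1, one_pos, fun v => ?_⟩
    have hv : v = 0 := by
      by_contra hv
      have : ‖v‖⁻¹ • v ∈ Metric.sphere (0 : E) 1 := by
        simp [norm_smul, norm_ne_zero_iff.2 hv]
      simp [hS] at this
    simp [hv]
  · obtain ⟨u, hu, hmin⟩ := (isCompact_sphere (0 : E) 1).exists_isMinOn hS
      p.continuous_of_finiteDimensional_real.continuousOn
    have hu1 : ‖u‖ = 1 := by simpa using hu
    refine ⟨p u, lt_of_le_of_ne (apply_nonneg p u) fun h => ?_, fun v => ?_⟩
    · simp [hp u h.symm] at hu1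
    · rcases eq_or_ne v 0 with rfl | hv
      · simp
      have hv' : 0 < ‖v‖ := norm_pos_iff.2 hv
      have hmem : ‖v‖⁻¹ • v ∈ Metric.sphere (0 : E) 1 := by
        simp [norm_smul, hv'.ne']
      have h : p u ≤ p (‖v‖⁻¹ • v) := hmin hmem
      rw [map_smul_eq_mul, norm_inv, norm_norm, inv_mul_eq_div, le_div_iff₀ hv'] at h
      exact h

theorem Seminorm.isCompact_closedUnitBall (p : Seminorm ℝ E) (hp : ∀ v, p v = 0 → v = 0) :
    IsCompact {v | p v ≤ 1} := by
  have hproper : ProperSpace E := FiniteDimensional.proper ℝ E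
  obtain ⟨c, hc, h⟩ := p.exists_pos_mul_norm_le hp
  refine (isCompact_closedBall (0 : E) c⁻¹).of_isClosed_subset
    (isClosed_le p.continuous_of_finiteDimensional_real continuous_const) fun v hv => ?_
  have hv' : p v ≤ 1 := hv
  rw [mem_closedBall_zero_iff, ← one_div, le_div_iff₀ hc]
  linarith [h v]

/-- Points of a unit ball whose margin tends to the maximal one converge to the unique maximizer. -/
theorem tendsto_of_tendsto_iInf_le {ι α : Type*} [Finite ι] [Nonempty ι] {l : Filter α}
    (p : Seminorm ℝ E) (hp : ∀ v, p v = 0 → v = 0) (f : ι → E →ₗ[ℝ] ℝ) {u : E} {γ : ℝ}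
    (hmax : ∀ w, p w ≤ 1 → ⨅ i, f i w ≤ γ)
    (huniq : ∀ w, p w ≤ 1 → ⨅ i, f i w = γ → w = u)
    {v : α → E} (hv : ∀ᶠ t in l, p (v t) ≤ 1)
    (hlim : ∀ η > 0, ∀ᶠ t in l, ∀ i, γ - η ≤ f i (v t)) :
    Filter.Tendsto v l (nhds u) := by
  refine (p.isCompact_closedUnitBall hp).tendsto_nhds_of_unique_mapClusterPt hv fun a ha hca => ?_
  refine huniq a ha (le_antisymm (hmax a ha) (le_ciInf fun i => ?_))
  refine le_of_forall_pos_sub_le fun η hη => ?_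
  have hcl : IsClosed {w | γ - η ≤ f i w} :=
    isClosed_le continuous_const (f i).continuous_of_finiteDimensional
  exact hcl.mem_of_mapClusterPt hca ((hlim η hη).mono fun t ht => ht i)

end SeminormFiniteDimensional

section RegularizationPath

variable {E ι : Type*} [AddCommGroup E] [Module ℝ E] [Fintype ι]
  {p : Seminorm ℝ E} {f : ι → E →ₗ[ℝ] ℝ} {u : E} {γ : ℝ}

theorem exists_le_mul_of_forall_unitBall [Nonempty ι] (hpz : ∀ v, p v = 0 → v = 0)
    (hmax : ∀ w, p w ≤ 1 → ⨅ i, f i w ≤ γ) (w : E) : ∃ i, f i w ≤ γ * p w := by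
  rcases (apply_nonneg p w).eq_or_lt with h | h
  · exact ⟨Classical.arbitrary ι, by simp [hpz w h.symm]⟩
  · obtain ⟨i, hi⟩ := exists_eq_ciInf_of_finite (f := fun i => f i ((p w)⁻¹ • w))
    have hle : f i ((p w)⁻¹ • w) ≤ γ := by
      rw [hi]
      refine hmax _ ?_
      rw [map_smul_eq_mul, Real.norm_of_nonneg (inv_nonneg.2 h.le), inv_mul_cancel₀ h.ne']
    rw [map_smul, smul_eq_mul, inv_mul_eq_div, div_le_iff₀ h] at hle
    exact ⟨i, hle⟩

/-- Comparison of a regularized exponential-loss minimizer with a multiple of a margin maximizer. -/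
theorem exp_add_le_of_regularized_min (hu : p u ≤ 1) (huγ : ∀ i, γ ≤ f i u) {lam : ℝ}
    (hlam : 0 < lam) {w : E}
    (hw : ∀ w', (∑ i, Real.exp (-f i w)) + lam * p w ≤ (∑ i, Real.exp (-f i w')) + lam * p w')
    {s : ℝ} (hs : 0 ≤ s) (i : ι) :
    Real.exp (-f i w) + lam * p w ≤ Fintype.card ι * Real.exp (-(γ * s)) + lam * s := by
  have h1 : Real.exp (-f i w) ≤ ∑ i, Real.exp (-f i w) :=
    Finset.single_le_sum (f := fun i => Real.exp (-f i w)) (fun i _ => (Real.exp_pos _).le)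
      (Finset.mem_univ i)
  have h2 : ∑ i, Real.exp (-f i (s • u)) ≤ Fintype.card ι * Real.exp (-(γ * s)) := by
    have : ∀ i ∈ Finset.univ, Real.exp (-f i (s • u)) ≤ Real.exp (-(γ * s)) := fun i _ => by
      rw [Real.exp_le_exp, map_smul, smul_eq_mul]
      nlinarith [huγ i]
    simpa using Finset.sum_le_card_nsmul _ _ _ this
  have h3 : lam * p (s • u) ≤ lam * s := by
    rw [map_smul_eq_mul, Real.norm_of_nonneg hs]
    exact mul_le_mul_of_nonneg_left (mul_le_of_le_one_right hs hu) hlam.le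
  linarith [hw (s • u)]

theorem tendsto_regularized_min_atTop [Nonempty ι] (hpz : ∀ v, p v = 0 → v = 0) (hγ : 0 < γ)
    (hu : p u ≤ 1) (huγ : ∀ i, γ ≤ f i u) (hmax : ∀ w, p w ≤ 1 → ⨅ i, f i w ≤ γ) {w : ℝ → E}
    (hw : ∀ lam, 0 < lam → ∀ w', (∑ i, Real.exp (-f i (w lam))) + lam * p (w lam) ≤
      (∑ i, Real.exp (-f i w')) + lam * p w') :
    Filter.Tendsto (fun lam => p (w lam)) (nhdsWithin 0 (Set.Ioi 0)) Filter.atTop := by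
  refine Filter.tendsto_atTop.2 fun R => ?_
  have hlim : Filter.Tendsto (fun s : ℝ => Fintype.card ι * Real.exp (-(γ * s)))
      Filter.atTop (nhds 0) := by
    simpa using (Real.tendsto_exp_neg_atTop_nhds_zero.comp
      (Filter.tendsto_id.const_mul_atTop hγ)).const_mul (Fintype.card ι : ℝ)
  obtain ⟨s, hs, hs0⟩ := ((hlim.eventually_lt_const (Real.exp_pos (-(γ * R)))).and
    (Filter.eventually_ge_atTop 0)).exists
  have hlim' : Filter.Tendsto (fun lam : ℝ => Fintype.card ι * Real.exp (-(γ * s)) + lam * s)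
      (nhdsWithin 0 (Set.Ioi 0)) (nhds (Fintype.card ι * Real.exp (-(γ * s)))) := by
    refine Filter.Tendsto.mono_left ?_ nhdsWithin_le_nhds
    exact Continuous.tendsto' (by fun_prop) _ _ (by simp)
  filter_upwards [hlim'.eventually_lt_const hs, self_mem_nhdsWithin] with lam h hlam
  obtain ⟨i, hi⟩ := exists_le_mul_of_forall_unitBall hpz hmax (w lam)
  have h1 := exp_add_le_of_regularized_min hu huγ hlam (hw lam hlam) hs0 i
  have h2 : 0 ≤ lam * p (w lam) := mul_nonneg (le_of_lt hlam) (apply_nonneg p _)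
  have h3 : Real.exp (-f i (w lam)) < Real.exp (-(γ * R)) := by linarith
  rw [Real.exp_lt_exp] at h3
  exact (lt_of_mul_lt_mul_left (by linarith : γ * R < γ * p (w lam)) hγ.le).le

theorem eventually_margin_normalized_regularized_min [Nonempty ι]
    (hpz : ∀ v, p v = 0 → v = 0) (hγ : 0 < γ)
    (hu : p u ≤ 1) (huγ : ∀ i, γ ≤ f i u) (hmax : ∀ w, p w ≤ 1 → ⨅ i, f i w ≤ γ) {w : ℝ → E}
    (hw : ∀ lam, 0 < lam → ∀ w', (∑ i, Real.exp (-f i (w lam))) + lam * p (w lam) ≤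
      (∑ i, Real.exp (-f i w')) + lam * p w') {η : ℝ} (hη : 0 < η) :
    ∀ᶠ lam in nhdsWithin 0 (Set.Ioi 0), ∀ i, γ - η ≤ f i ((p (w lam))⁻¹ • w lam) := by
  have htop := tendsto_regularized_min_atTop hpz hγ hu huγ hmax hw
  filter_upwards [htop.eventually_gt_atTop 0,
    htop.eventually_ge_atTop (Real.log (Fintype.card ι) / η), self_mem_nhdsWithin]
    with lam hpos hbig hlam i
  have hcard : (0 : ℝ) < Fintype.card ι := by exact_mod_cast Fintype.card_pos
  have h1 := exp_add_le_of_regularized_min hu huγ hlam (hw lam hlam) hpos.le i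
  have h2 : Real.exp (-f i (w lam)) ≤
      Real.exp (Real.log (Fintype.card ι) + -(γ * p (w lam))) := by
    rw [Real.exp_add, Real.exp_log hcard]
    linarith
  rw [Real.exp_le_exp] at h2
  rw [div_le_iff₀ hη] at hbig
  rw [map_smul, smul_eq_mul, inv_mul_eq_div, le_div_iff₀ hpos]
  linarith

end RegularizationPath

theorem Seminorm.exists_linear_eq_and_abs_le {E : Type*} [AddCommGroup E] [Module ℝ E]
    (p : Seminorm ℝ E) (w : E) : ∃ g : E →ₗ[ℝ] ℝ, g w = p w ∧ ∀ v, |g v| ≤ p v := by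
  rcases eq_or_ne w 0 with rfl | hw
  · exact ⟨0, by simp, fun v => by simp⟩
  obtain ⟨g, hg, hgp⟩ := exists_extension_of_le_sublinear
    (LinearPMap.mkSpanSingleton (σ := RingHom.id ℝ) w (p w) hw) p
    (fun c hc v => by rw [map_smul_eq_mul, Real.norm_of_nonneg hc.le]) (map_add_le_add p) (by
      rintro ⟨v, hv⟩
      obtain ⟨c, rfl⟩ := Submodule.mem_span_singleton.1 hv
      rw [LinearPMap.mkSpanSingleton'_apply, map_smul_eq_mul]
      exact mul_le_mul_of_nonneg_right (le_abs_self c) (apply_nonneg p w))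
  refine ⟨g, ?_, fun v => abs_le.2 ⟨?_, hgp v⟩⟩
  · exact (hg ⟨w, Submodule.mem_span_singleton_self w⟩).trans
      (LinearPMap.mkSpanSingleton'_apply_self _ _ _ _)
  · have h := hgp (-v)
    rw [map_neg, map_neg_eq_map] at h
    linarith

section DualNorm

variable {d : ℕ} (p : Seminorm ℝ (Fin d → ℝ))

theorem abs_sum_mul_le_dualNorm (hp : ∀ v, p v = 0 → v = 0) {u : Fin d → ℝ} (hu : p u ≤ 1)
    (δ : Fin d → ℝ) : |∑ j, δ j * u j| ≤ dualNorm p δ := by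
  refine le_csSup ?_ ⟨u, hu, rfl⟩
  have hcont : Continuous fun v : Fin d → ℝ => |∑ j, δ j * v j| := by fun_prop
  obtain ⟨B, hB⟩ := (p.isCompact_closedUnitBall hp).bddAbove_image hcont.continuousOn
  refine ⟨B, ?_⟩
  rintro t ⟨v, hv, rfl⟩
  exact hB ⟨v, hv, rfl⟩

theorem dualNorm_le_s19 {δ : Fin d → ℝ} {C : ℝ} (h : ∀ v, p v ≤ 1 → |∑ j, δ j * v j| ≤ C) :
    dualNorm p δ ≤ C := by
  refine csSup_le ⟨_, 0, by simp, rfl⟩ ?_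
  rintro t ⟨v, hv, rfl⟩
  exact h v hv

theorem exists_dualNorm_le_and_sum_mul_eq {w : Fin d → ℝ} {C : ℝ} (hC : 0 ≤ C) :
    ∃ δ, dualNorm p δ ≤ C ∧ ∑ j, w j * δ j = C * p w := by
  obtain ⟨g, hgw, hg⟩ := p.exists_linear_eq_and_abs_le w
  have hsum : ∀ v : Fin d → ℝ, ∑ j, v j * g (Pi.single j 1) = g v := fun v => by
    conv_rhs => rw [pi_eq_sum_univ' v]
    simp [map_sum, smul_eq_mul]
  refine ⟨fun j => C * g (Pi.single j 1), dualNorm_le_s19 p fun v hv => ?_, ?_⟩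
  · have : ∑ j, C * g (Pi.single j 1) * v j = C * g v := by
      rw [← hsum v, Finset.mul_sum]
      exact Finset.sum_congr rfl fun j _ => by ring
    rw [this, abs_mul, abs_of_nonneg hC]
    exact mul_le_of_le_one_right hC ((hg v).trans hv)
  · rw [← hgw, ← hsum w, Finset.mul_sum]
    exact Finset.sum_congr rfl fun j _ => by ring

theorem dualNorm_neg (N : (Fin d → ℝ) → ℝ) (δ : Fin d → ℝ) : dualNorm N (-δ) = dualNorm N δ := by
  simp [dualNorm]

end DualNorm

/-- For linearly separable data (through the origin), if `w*` is the unique maximizer of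
the margin over the `N`-unit ball with maximum margin `γ > 0`, and `ŵ(λ)` minimizes the
`N`-regularized exponential-loss empirical risk for each `λ > 0`, then `ŵ(λ)/N(ŵ(λ))`
converges to `w*` as `λ → 0⁺`, and `w*` is maximally robust with respect to the dual
norm: it is robust for every `ε < γ` while no linear classifier is robust for any
`ε > γ`. -/
theorem stmt19 {d n : ℕ} (hn : 0 < n)
    (N : (Fin d → ℝ) → ℝ)
    (hN_tri : ∀ u v : Fin d → ℝ, N (u + v) ≤ N u + N v)
    (hN_smul : ∀ (c : ℝ) (v : Fin d → ℝ), N (c • v) = |c| * N v)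
    (hN_eq : ∀ v : Fin d → ℝ, N v = 0 → v = 0)
    (x : Fin n → Fin d → ℝ) (y : Fin n → ℝ)
    (hy : ∀ i, y i = 1 ∨ y i = -1)
    (hsep : ∃ w : Fin d → ℝ, ∀ i, 0 < y i * ∑ j, w j * x i j)
    (wstar : Fin d → ℝ) (γ : ℝ) (hγpos : 0 < γ)
    (hwstar_ball : N wstar ≤ 1)
    (hwstar_margin : γ = ⨅ i, y i * ∑ j, wstar j * x i j)
    (hwstar_max : ∀ w : Fin d → ℝ, N w ≤ 1 → (⨅ i, y i * ∑ j, w j * x i j) ≤ γ)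
    (hwstar_unique : ∀ w : Fin d → ℝ, N w ≤ 1 →
        (⨅ i, y i * ∑ j, w j * x i j) = γ → w = wstar)
    (what : ℝ → Fin d → ℝ)
    (hwhat : ∀ lam : ℝ, 0 < lam → ∀ w' : Fin d → ℝ,
        (∑ i, Real.exp (-(y i) * ∑ j, what lam j * x i j)) + lam * N (what lam)
          ≤ (∑ i, Real.exp (-(y i) * ∑ j, w' j * x i j)) + lam * N w') :
    Filter.Tendsto (fun lam => (N (what lam))⁻¹ • what lam)
      (nhdsWithin 0 (Set.Ioi (0 : ℝ))) (nhds wstar) ∧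
    (∀ ε : ℝ, ε < γ → ∀ (i : Fin n) (δ : Fin d → ℝ), dualNorm N δ ≤ ε →
        0 < y i * ∑ j, wstar j * (x i j + δ j)) ∧
    (∀ ε : ℝ, γ < ε →
        ¬ ∃ w : Fin d → ℝ, ∀ (i : Fin n) (δ : Fin d → ℝ), dualNorm N δ ≤ ε →
            0 < y i * ∑ j, w j * (x i j + δ j)) := by
  have : Nonempty (Fin n) := ⟨⟨0, hn⟩⟩
  let p : Seminorm ℝ (Fin d → ℝ) := Seminorm.of N hN_tri hN_smul
  have hpz : ∀ v, p v = 0 → v = 0 := hN_eq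
  let f : Fin n → (Fin d → ℝ) →ₗ[ℝ] ℝ := fun i => y i • ∑ j, x i j • LinearMap.proj j
  have hf : ∀ i w, f i w = y i * ∑ j, w j * x i j := fun i w => by
    simp [f, mul_comm]
  have hmargin : ∀ i, γ ≤ f i wstar := fun i => by
    rw [hf, hwstar_margin]
    exact ciInf_le (Set.finite_range _).bddBelow i
  have hmax : ∀ w, p w ≤ 1 → ⨅ i, f i w ≤ γ := fun w hw => by
    simpa only [hf] using hwstar_max w hw
  have huniq : ∀ w, p w ≤ 1 → ⨅ i, f i w = γ → w = wstar := fun w hw h =>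
    hwstar_unique w hw (by simpa only [hf] using h)
  have hmin : ∀ lam, 0 < lam → ∀ w', (∑ i, Real.exp (-f i (what lam))) + lam * p (what lam) ≤
      (∑ i, Real.exp (-f i w')) + lam * p w' := fun lam hlam w' => by
    have h := hwhat lam hlam w'
    simp only [neg_mul] at h
    simp only [hf]
    exact h
  have hsq : ∀ i, y i * y i = 1 := fun i => by rcases hy i with h | h <;> simp [h]
  have hsplit : ∀ i (w δ : Fin d → ℝ),
      y i * ∑ j, w j * (x i j + δ j) = f i w + y i * ∑ j, w j * δ j :=
    fun i w δ => by simp only [hf, mul_add, Finset.sum_add_distrib]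
  refine ⟨?_, fun ε hε i δ hδ => ?_, ?_⟩
  · refine tendsto_of_tendsto_iInf_le p hpz f hmax huniq (.of_forall fun lam => ?_)
      fun η hη => eventually_margin_normalized_regularized_min hpz hγpos hwstar_ball hmargin
        hmax hmin hη
    change p ((p (what lam))⁻¹ • what lam) ≤ 1
    rw [map_smul_eq_mul, Real.norm_of_nonneg (inv_nonneg.2 (apply_nonneg p _))]
    exact inv_mul_le_one
  · have h : |∑ j, δ j * wstar j| ≤ dualNorm N δ := abs_sum_mul_le_dualNorm p hpz hwstar_ball δ
    have habs : |y i * ∑ j, wstar j * δ j| = |∑ j, δ j * wstar j| := by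
      have hy1 : |y i| = 1 := by rcases hy i with h | h <;> simp [h]
      simp only [abs_mul, hy1, one_mul, mul_comm (wstar _)]
    rw [hsplit]
    linarith [hmargin i, neg_abs_le (y i * ∑ j, wstar j * δ j)]
  · rintro ε hε ⟨w, hw⟩
    obtain ⟨i, hi⟩ := exists_le_mul_of_forall_unitBall hpz hmax w
    obtain ⟨δ, hδ, hδw⟩ := exists_dualNorm_le_and_sum_mul_eq p (w := w) hγpos.le
    have hδε : dualNorm N δ ≤ ε := hδ.trans hε.le
    have hδy : dualNorm N (-(y i • δ)) ≤ ε := by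
      rw [dualNorm_neg]
      rcases hy i with h | h <;> simpa [h, dualNorm_neg] using hδε
    have h := hw i _ hδy
    have hsum : ∑ j, w j * (-(y i • δ)) j = -(y i * ∑ j, w j * δ j) := by
      simp [Finset.mul_sum, mul_left_comm]
    rw [hsplit, hsum, mul_neg, ← mul_assoc, hsq, hδw] at h
    linarith
end
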